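/- Let z ∼ N(μ_z, Σ_z) be a Gaussian vector in ℝ^d, let f_1,…,f_p ∈ ℝ^d, set v_i = Σ_z^{1/2} f_i, and let σ : ℝ → ℝ be L-Lipschitz with E[σ(g)] = 0 for g ∼ N(0,1). Define μ ∈ ℝ^p by μ_i = E[σ(f_iᵀ z)]. Then ‖μ‖₂² ≤ 2L²(Σ_{i=1}^p (f_iᵀ μ_z)² + Σ_{i=1}^p (‖v_i‖₂ − 1)²); in particular, if F is the matrix with columns f_i, then ‖μ‖₂² ≤ 2L²(‖F‖_op² ‖μ_z‖₂² + Σ_{i=1}^p (‖v_i‖₂ − 1)²). -/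

import Mathlib

open MeasureTheory ProbabilityTheory

/-- A Lipschitz function of an integrable real random variable is integrable. -/
theorem LipschitzWith.integrable_comp {Ω : Type*} [MeasurableSpace Ω] {P : Measure Ω}
    [IsFiniteMeasure P] {σ : ℝ → ℝ} {L : NNReal} (hσ : LipschitzWith L σ) {X : Ω → ℝ}
    (hX : Integrable X P) : Integrable (fun ω => σ (X ω)) P := by
  refine Integrable.mono' ((hX.norm.const_mul (L : ℝ)).add (integrable_const |σ 0|))
    (hσ.continuous.comp_aestronglyMeasurable hX.aestronglyMeasurable) (ae_of_all _ fun ω => ?_)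
  have h := hσ.dist_le_mul (X ω) 0
  have h' := abs_sub_abs_le_abs_sub (σ (X ω)) (σ 0)
  simp only [Real.dist_eq, sub_zero] at h
  simp only [Pi.add_apply, Real.norm_eq_abs]
  linarith

/-- The second moment of `m + c * g` for a standard Gaussian `g` controls its first absolute
moment. -/
theorem sq_integral_abs_affine_gaussianReal_le (m c : ℝ) :
    (∫ t, |m + c * t| ∂(gaussianReal 0 1)) ^ 2 ≤ m ^ 2 + c ^ 2 := by
  have hid : MemLp (fun t : ℝ => t) 2 (gaussianReal 0 1) := memLp_id_gaussianReal 2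
  have hX : MemLp (fun t : ℝ => m + c * t) 2 (gaussianReal 0 1) :=
    (memLp_const m).add (hid.const_mul c)
  have hvar := variance_eq_sub hX
  have habs := variance_eq_sub hX.abs
  have hnonneg := variance_nonneg |fun t : ℝ => m + c * t| (gaussianReal 0 1)
  have hmean : ∫ t, m + c * t ∂(gaussianReal 0 1) = m := by
    rw [integral_add (integrable_const m) ((hid.integrable (by norm_num)).const_mul c),
      integral_const_mul]
    simp
  have hv : Var[fun t : ℝ => m + c * t; gaussianReal 0 1] = c ^ 2 := by
    rw [variance_const_add (by fun_prop), variance_const_mul, variance_fun_id_gaussianReal]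
    simp
  simp only [Pi.pow_apply, Pi.abs_apply, sq_abs] at hvar habs
  rw [hv, hmean] at hvar
  linarith

/-- If `σ` is `L`-Lipschitz and centered under `N(0, 1)`, its mean under `N(m, s²)` is at most
`L` times the `L²` transport cost from `N(0, 1)` to `N(m, s²)`. -/
theorem LipschitzWith.sq_integral_gaussianReal_le {σ : ℝ → ℝ} {L : NNReal}
    (hσ : LipschitzWith L σ) (hmean0 : ∫ t, σ t ∂(gaussianReal 0 1) = 0) (m s : ℝ) :
    (∫ t, σ t ∂(gaussianReal m (Real.toNNReal (s ^ 2)))) ^ 2 ≤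
      (L : ℝ) ^ 2 * (m ^ 2 + (s - 1) ^ 2) := by
  have hid : Integrable (fun t : ℝ => t) (gaussianReal 0 1) :=
    (memLp_id_gaussianReal 1).integrable le_rfl
  have haff (c : ℝ) : Integrable (fun t : ℝ => m + c * t) (gaussianReal 0 1) :=
    (integrable_const m).add (hid.const_mul c)
  have hlaw : gaussianReal m (Real.toNNReal (s ^ 2)) =
      (gaussianReal 0 1).map (fun t => m + s * t) := by
    rw [show (fun t => m + s * t) = (fun t => m + t) ∘ fun t => s * t from rfl,
      ← Measure.map_map (by fun_prop) (by fun_prop), gaussianReal_map_const_mul, gaussianReal_map_const_add]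
    congr 1
    · ring
    · ext
      simp [Real.coe_toNNReal _ (sq_nonneg s)]
  have hshift : ∫ t, σ t ∂(gaussianReal m (Real.toNNReal (s ^ 2))) =
      ∫ t, (σ (m + s * t) - σ t) ∂(gaussianReal 0 1) := by
    rw [hlaw, integral_map (by fun_prop) hσ.continuous.aestronglyMeasurable,
      integral_sub (hσ.integrable_comp (haff s)) (hσ.integrable_comp hid), hmean0, sub_zero]
  have hle : |∫ t, (σ (m + s * t) - σ t) ∂(gaussianReal 0 1)| ≤
      L * ∫ t, |m + (s - 1) * t| ∂(gaussianReal 0 1) := by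
    rw [← integral_const_mul, ← Real.norm_eq_abs]
    refine norm_integral_le_of_norm_le ((haff (s - 1)).abs.const_mul _) (ae_of_all _ fun t => ?_)
    have h := hσ.dist_le_mul (m + s * t) t
    rwa [Real.dist_eq, Real.dist_eq, show m + s * t - t = m + (s - 1) * t by ring] at h
  rw [hshift, ← sq_abs]
  calc _ ≤ (L * ∫ t, |m + (s - 1) * t| ∂(gaussianReal 0 1)) ^ 2 := by gcongr
    _ ≤ _ := by
      rw [mul_pow]
      gcongr
      exact sq_integral_abs_affine_gaussianReal_le m (s - 1)

/-- The quadratic form of `R * R`, for a symmetric `R`, is the squared norm of `R *ᵥ θ`. -/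
theorem sum_mul_sum_mul_self_of_symm {ι : Type*} [Fintype ι] {R S : ι → ι → ℝ}
    (hsymm : ∀ i j, R i j = R j i) (hRS : ∀ i j, ∑ l, R i l * R l j = S i j) (θ : ι → ℝ) :
    ∑ i, ∑ j, θ i * S i j * θ j = ∑ l, (∑ i, R l i * θ i) ^ 2 := by
  calc ∑ i, ∑ j, θ i * S i j * θ j
      = ∑ i, ∑ j, ∑ l, (R l i * θ i) * (R l j * θ j) := by
        refine Finset.sum_congr rfl fun i _ => Finset.sum_congr rfl fun j _ => ?_
        rw [← hRS, Finset.mul_sum, Finset.sum_mul]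
        refine Finset.sum_congr rfl fun l _ => ?_
        rw [hsymm i l]
        ring
    _ = ∑ i, ∑ l, ∑ j, (R l i * θ i) * (R l j * θ j) :=
        Finset.sum_congr rfl fun i _ => Finset.sum_comm
    _ = ∑ l, ∑ i, ∑ j, (R l i * θ i) * (R l j * θ j) := Finset.sum_comm
    _ = ∑ l, (∑ i, R l i * θ i) ^ 2 := by simp only [sq, Finset.sum_mul_sum]

/-- **Bound on the mean of random features.**
Let `z ∼ N(μz, Sz)` in `ℝ^d` (Gaussianity expressed through all one-dimensional
linear projections), `f 1, …, f p ∈ ℝ^d`, `v i = Sz^{1/2} (f i)` (with `Rt` a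
symmetric square root of `Sz`), and let `σ` be `L`-Lipschitz with mean zero under
`N(0,1)`.  Then the mean vector `μ i = E[σ(f iᵀ z)]` satisfies
`‖μ‖² ≤ 2L²(Σᵢ (f iᵀ μz)² + Σᵢ (‖v i‖ − 1)²)`, and with `CF` any bound on the
operator norm of the matrix with columns `f i`,
`‖μ‖² ≤ 2L²(CF² ‖μz‖² + Σᵢ (‖v i‖ − 1)²)`. -/
theorem random_feature_mean_bound (d p : ℕ)
    (μz : Fin d → ℝ) (Sz : Fin d → Fin d → ℝ)
    (Pz : Measure (Fin d → ℝ)) [IsProbabilityMeasure Pz]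
    (hGauss : ∀ θ : Fin d → ℝ, Pz.map (fun z => ∑ i, θ i * z i) =
      gaussianReal (∑ i, θ i * μz i)
        (Real.toNNReal (∑ i, ∑ j, θ i * Sz i j * θ j)))
    (f : Fin p → Fin d → ℝ)
    (Rt : Fin d → Fin d → ℝ) (hRtsymm : ∀ i j, Rt i j = Rt j i)
    (hRt : ∀ i j, ∑ l, Rt i l * Rt l j = Sz i j)
    (v : Fin p → Fin d → ℝ) (hv : ∀ i j, v i j = ∑ l, Rt j l * f i l)
    (σ : ℝ → ℝ) (L : NNReal) (hσ : LipschitzWith L σ)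
    (hmean0 : ∫ t, σ t ∂(gaussianReal 0 1) = 0)
    (μ : Fin p → ℝ) (hμ : ∀ i, μ i = ∫ z, σ (∑ l, f i l * z l) ∂Pz)
    (CF : ℝ)
    (hCF : ∀ w : Fin d → ℝ, Real.sqrt (∑ i, (∑ l, f i l * w l) ^ 2) ≤
      CF * Real.sqrt (∑ l, (w l) ^ 2)) :
    (∑ i, (μ i) ^ 2 ≤ 2 * (L : ℝ) ^ 2 * ((∑ i, (∑ l, f i l * μz l) ^ 2) +
        ∑ i, (Real.sqrt (∑ l, (v i l) ^ 2) - 1) ^ 2)) ∧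
      ∑ i, (μ i) ^ 2 ≤ 2 * (L : ℝ) ^ 2 * (CF ^ 2 * (∑ l, (μz l) ^ 2) +
        ∑ i, (Real.sqrt (∑ l, (v i l) ^ 2) - 1) ^ 2) := by
  have hentry (i : Fin p) : (μ i) ^ 2 ≤ (L : ℝ) ^ 2 *
      ((∑ l, f i l * μz l) ^ 2 + (Real.sqrt (∑ l, (v i l) ^ 2) - 1) ^ 2) := by
    have hquad : ∑ j, ∑ k, f i j * Sz j k * f i k = Real.sqrt (∑ l, (v i l) ^ 2) ^ 2 := by
      rw [Real.sq_sqrt (by positivity), sum_mul_sum_mul_self_of_symm hRtsymm hRt]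
      simp only [hv]
    have hmeas : Measurable fun z : Fin d → ℝ => ∑ l, f i l * z l :=
      Finset.measurable_fun_sum _ fun l _ => (measurable_pi_apply l).const_mul _
    have hmean : μ i = ∫ t, σ t ∂(Pz.map fun z => ∑ l, f i l * z l) := by
      rw [hμ, integral_map hmeas.aemeasurable hσ.continuous.aestronglyMeasurable]
    rw [hmean, hGauss, hquad]
    exact hσ.sq_integral_gaussianReal_le hmean0 _ _
  have hmain : ∑ i, (μ i) ^ 2 ≤ 2 * (L : ℝ) ^ 2 * ((∑ i, (∑ l, f i l * μz l) ^ 2) +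
      ∑ i, (Real.sqrt (∑ l, (v i l) ^ 2) - 1) ^ 2) := by
    calc _ ≤ (L : ℝ) ^ 2 * ((∑ i, (∑ l, f i l * μz l) ^ 2) +
          ∑ i, (Real.sqrt (∑ l, (v i l) ^ 2) - 1) ^ 2) := by
          rw [← Finset.sum_add_distrib, Finset.mul_sum]
          exact Finset.sum_le_sum fun i _ => hentry i
      _ ≤ _ := by
          gcongr
          exact le_mul_of_one_le_left (sq_nonneg _) one_le_two
  refine ⟨hmain, hmain.trans ?_⟩
  gcongr
  have h := pow_le_pow_left₀ (Real.sqrt_nonneg _) (hCF μz) 2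
  rwa [mul_pow, Real.sq_sqrt (by positivity), Real.sq_sqrt (by positivity)] at h
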